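/- arXiv:2206.09648 — 6 statements merged into one kernel-verified Lean document; each statement's English description precedes it below -/
import Mathlib

section
/- Let d ≥ 1 be an integer, let a, b ∈ ℝ^d with a ≠ b, and let 0 < δ ≤ π/4. Let P = (v₀, v₁, …, v_m) be a polygonal path in ℝ^d with v₀ = a and v_m = b such that for every i ∈ {1, …, m} we have v_{i−1} ≠ v_i, ⟨v_i − v_{i−1}, b − a⟩ ≥ 0, and the angle between the vectors v_i − v_{i−1} and b − a is at most δ. Then the weight of P satisfies ∑_{i=1}^m ‖v_i − v_{i−1}‖ ≤ (1 + δ²)·‖b − a‖. -/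
open scoped RealInnerProductSpace

/-- On `[0, 1]` the secant is bounded by `1 + δ²`. -/
theorem one_le_one_add_sq_mul_cos {δ : ℝ} (hδ0 : 0 ≤ δ) (hδ1 : δ ≤ 1) :
    1 ≤ (1 + δ ^ 2) * Real.cos δ := by
  have hcos : 1 - δ ^ 2 / 2 ≤ Real.cos δ := Real.one_sub_sq_div_two_le_cos
  have hsq : δ ^ 2 ≤ 1 := pow_le_one₀ hδ0 hδ1
  nlinarith [sq_nonneg δ]

/-- If `x` makes angle at most `δ ≤ π` with `y`, then the inner product of `x` and `y` is at least
`cos δ * (‖x‖ * ‖y‖)`. -/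
theorem cos_mul_norm_mul_norm_le_inner {E : Type*} [NormedAddCommGroup E] [InnerProductSpace ℝ E]
    {x y : E} {δ : ℝ} (hδ : δ ≤ Real.pi) (h : InnerProductGeometry.angle x y ≤ δ) :
    Real.cos δ * (‖x‖ * ‖y‖) ≤ ⟪x, y⟫ := by
  rw [← InnerProductGeometry.cos_angle_mul_norm_mul_norm]
  gcongr
  exact Real.cos_le_cos_of_nonneg_of_le_pi (InnerProductGeometry.angle_nonneg x y) hδ h

/-- If a polygonal path from `a` to `b` in `ℝ^d` is monotone in direction
`b - a` and every edge makes angle at most `δ ≤ π/4` with `b - a`, then its weight is at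
most `(1 + δ²)·‖b - a‖`. -/
theorem weight_le_of_angle_bounded
    (d : ℕ) (hd : 1 ≤ d) (a b : EuclideanSpace ℝ (Fin d)) (hab : a ≠ b)
    (δ : ℝ) (hδ0 : 0 < δ) (hδ : δ ≤ Real.pi / 4)
    (m : ℕ) (v : ℕ → EuclideanSpace ℝ (Fin d)) (hv0 : v 0 = a) (hvm : v m = b)
    (hne : ∀ i < m, v i ≠ v (i + 1))
    (hmono : ∀ i < m, 0 ≤ ⟪v (i + 1) - v i, b - a⟫)
    (hang : ∀ i < m, InnerProductGeometry.angle (v (i + 1) - v i) (b - a) ≤ δ) :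
    ∑ i ∈ Finset.range m, ‖v (i + 1) - v i‖ ≤ (1 + δ ^ 2) * ‖b - a‖ := by
  have hpos : 0 < ‖b - a‖ := norm_pos_iff.mpr (sub_ne_zero.mpr hab.symm)
  set S := ∑ i ∈ Finset.range m, ‖v (i + 1) - v i‖ with hS
  have hS0 : 0 ≤ S := Finset.sum_nonneg fun _ _ => norm_nonneg _
  have hproj : Real.cos δ * S ≤ ‖b - a‖ := by
    refine le_of_mul_le_mul_right ?_ hpos
    calc Real.cos δ * S * ‖b - a‖
        = ∑ i ∈ Finset.range m, Real.cos δ * (‖v (i + 1) - v i‖ * ‖b - a‖) := by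
          rw [hS, mul_assoc, Finset.sum_mul, Finset.mul_sum]
      _ ≤ ∑ i ∈ Finset.range m, ⟪v (i + 1) - v i, b - a⟫ :=
          Finset.sum_le_sum fun i hi => cos_mul_norm_mul_norm_le_inner
            (by linarith [Real.pi_pos]) (hang i (Finset.mem_range.mp hi))
      _ = ‖b - a‖ * ‖b - a‖ := by
          rw [← sum_inner, Finset.sum_range_sub, hv0, hvm, real_inner_self_eq_norm_mul_norm]
  calc S ≤ (1 + δ ^ 2) * Real.cos δ * S :=
        le_mul_of_one_le_left hS0
          (one_le_one_add_sq_mul_cos hδ0.le (by linarith [Real.pi_le_four]))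
    _ ≤ (1 + δ ^ 2) * ‖b - a‖ := by
        rw [mul_assoc]
        gcongr
end

section
/- Let d ≥ 1 be an integer, let a, b ∈ ℝ^d with a ≠ b, and let ε > 0. Let P = (v₀, v₁, …, v_m) be a polygonal path with v₀ = a, v_m = b, v_{i−1} ≠ v_i for all i, and weight ∑_{i=1}^m ‖v_i − v_{i−1}‖ ≤ (1+ε)·‖b − a‖. For α > 0 let E(α) denote the total weight of the edges v_{i−1}v_i whose undirected angle with the segment ab is strictly less than α. Then for every integer i with 1 ≤ i ≤ ⌊(π/2)/√ε⌋ we have E(i·√ε) ≥ (1 − 2/i²)·‖b − a‖. -/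
open scoped RealInnerProductSpace

/-- The undirected angle between two (direction) vectors:
`arccos (|⟨u,w⟩| / (‖u‖·‖w‖)) ∈ [0, π/2]`. -/
noncomputable def uangle {d : ℕ} (u w : EuclideanSpace ℝ (Fin d)) : ℝ :=
  Real.arccos (|⟪u, w⟫| / (‖u‖ * ‖w‖))

/-- The bound `1 + x² / 2 ≤ sec x` on `[0, π / 2)`, cleared of denominators. -/
theorem cos_mul_sq_add_two_le {x : ℝ} (hx0 : 0 ≤ x) (hx : x ≤ Real.pi / 2) :
    Real.cos x * (x ^ 2 + 2) ≤ 2 := by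
  have hhalf : Real.cos (x / 2) ≤ 1 / √((x / 2) ^ 2 + 1) :=
    Real.cos_le_one_div_sqrt_sq_add_one (by linarith [Real.pi_pos]) (by linarith [Real.pi_pos])
  have hnonneg : 0 ≤ Real.cos (x / 2) :=
    Real.cos_nonneg_of_mem_Icc ⟨by linarith [Real.pi_pos], by linarith [Real.pi_pos]⟩
  have hpos : 0 < (x / 2) ^ 2 + 1 := by positivity
  have hsq : Real.cos (x / 2) ^ 2 ≤ 1 / ((x / 2) ^ 2 + 1) := by
    calc Real.cos (x / 2) ^ 2 ≤ (1 / √((x / 2) ^ 2 + 1)) ^ 2 := by gcongr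
      _ = 1 / ((x / 2) ^ 2 + 1) := by rw [div_pow, one_pow, Real.sq_sqrt hpos.le]
  have hcos : Real.cos x = 2 * Real.cos (x / 2) ^ 2 - 1 := by
    rw [← Real.cos_two_mul]; ring_nf
  rw [le_div_iff₀ hpos] at hsq
  refine le_of_mul_le_mul_right ?_ hpos
  rw [hcos]
  nlinarith [mul_le_mul_of_nonneg_right hsq (by positivity : 0 ≤ x ^ 2 + 2), sq_nonneg (x ^ 2)]

/-- A vector at undirected angle at least `α` from `w` has inner product with `w` at most
`cos α` times the product of the norms. -/
theorem inner_le_mul_cos_of_le_uangle {d : ℕ} {u w : EuclideanSpace ℝ (Fin d)} {α : ℝ}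
    (hα : 0 ≤ α) (h : α ≤ uangle u w) : ⟪u, w⟫ ≤ ‖u‖ * ‖w‖ * Real.cos α := by
  rcases eq_or_ne u 0 with rfl | hu
  · simp
  rcases eq_or_ne w 0 with rfl | hw
  · simp
  have hpos : 0 < ‖u‖ * ‖w‖ := mul_pos (norm_pos_iff.2 hu) (norm_pos_iff.2 hw)
  have hle : |⟪u, w⟫| / (‖u‖ * ‖w‖) ≤ 1 := (div_le_one hpos).2 (abs_real_inner_le_norm u w)
  have hge : 0 ≤ |⟪u, w⟫| / (‖u‖ * ‖w‖) := by positivity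
  have hcos := Real.cos_le_cos_of_nonneg_of_le_pi hα (Real.arccos_le_pi _) h
  rw [Real.cos_arccos (by linarith) hle, div_le_iff₀ hpos] at hcos
  linarith [le_abs_self (⟪u, w⟫ : ℝ)]

-- **Statement 1.** If a polygonal path from `a` to `b` has weight at most `(1+ε)·‖b-a‖`,
-- then for every `1 ≤ i ≤ ⌊(π/2)/√ε⌋`, the total weight `E(i·√ε)` of its edges making
-- undirected angle strictly less than `i·√ε` with `ab` is at least `(1 − 2/i²)·‖b − a‖`.
open Classical in
theorem nearly_parallel_weight
    (d : ℕ) (hd : 1 ≤ d) (a b : EuclideanSpace ℝ (Fin d)) (hab : a ≠ b)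
    (ε : ℝ) (hε : 0 < ε)
    (m : ℕ) (v : ℕ → EuclideanSpace ℝ (Fin d)) (hv0 : v 0 = a) (hvm : v m = b)
    (hne : ∀ i < m, v i ≠ v (i + 1))
    (hW : ∑ i ∈ Finset.range m, ‖v (i + 1) - v i‖ ≤ (1 + ε) * ‖b - a‖)
    (i : ℕ) (hi1 : 1 ≤ i) (hi2 : i ≤ ⌊(Real.pi / 2) / Real.sqrt ε⌋₊) :
    (1 - 2 / (i : ℝ) ^ 2) * ‖b - a‖ ≤
      ∑ j ∈ (Finset.range m).filter
          (fun j => uangle (v (j + 1) - v j) (b - a) < (i : ℝ) * Real.sqrt ε),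
        ‖v (j + 1) - v j‖ := by
  set α : ℝ := (i : ℝ) * √ε with hα_def
  set L : ℝ := ‖b - a‖
  have hL : 0 < L := norm_pos_iff.2 (sub_ne_zero.2 hab.symm)
  have hsqrt : 0 < √ε := Real.sqrt_pos.2 hε
  have hi : (0 : ℝ) < i := by exact_mod_cast hi1
  have hα0 : 0 ≤ α := by positivity
  have hα_le : α ≤ Real.pi / 2 := by
    rw [hα_def, ← le_div_iff₀ hsqrt]
    exact (Nat.le_floor_iff (by positivity)).1 hi2
  have hα_sq : α ^ 2 = (i : ℝ) ^ 2 * ε := by rw [hα_def, mul_pow, Real.sq_sqrt hε.le]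
  have hcos := cos_mul_sq_add_two_le hα0 hα_le
  let near : ℕ → Prop := fun j => uangle (v (j + 1) - v j) (b - a) < α
  have hsplit := Finset.sum_filter_add_sum_filter_not (Finset.range m) near
    fun j => ‖v (j + 1) - v j‖
  change _ ≤ ∑ j ∈ (Finset.range m).filter near, ‖v (j + 1) - v j‖
  set S := ∑ j ∈ (Finset.range m).filter near, ‖v (j + 1) - v j‖
  set B := ∑ j ∈ (Finset.range m).filter (fun j => ¬ near j), ‖v (j + 1) - v j‖
  have hB : 0 ≤ B := Finset.sum_nonneg fun _ _ => norm_nonneg _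
  have hproj : L * L ≤ (S + B * Real.cos α) * L := by
    calc L * L = ∑ j ∈ Finset.range m, (⟪v (j + 1) - v j, b - a⟫ : ℝ) := by
          rw [← sum_inner, Finset.sum_range_sub, hv0, hvm, real_inner_self_eq_norm_mul_norm]
      _ = ∑ j ∈ (Finset.range m).filter near, (⟪v (j + 1) - v j, b - a⟫ : ℝ)
          + ∑ j ∈ (Finset.range m).filter (fun j => ¬ near j),
            (⟪v (j + 1) - v j, b - a⟫ : ℝ) :=
          (Finset.sum_filter_add_sum_filter_not _ _ _).symm
      _ ≤ S * L + B * (L * Real.cos α) := by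
          rw [Finset.sum_mul, Finset.sum_mul]
          refine add_le_add (Finset.sum_le_sum fun j _ => real_inner_le_norm _ _)
            (Finset.sum_le_sum fun j hj => ?_)
          rw [← mul_assoc]
          exact inner_le_mul_cos_of_le_uangle hα0 (not_lt.1 (Finset.mem_filter.1 hj).2)
      _ = (S + B * Real.cos α) * L := by ring
  have hproj' : L ≤ S + B * Real.cos α := le_of_mul_le_mul_right hproj hL
  have hbad : B * Real.cos α ≤ 2 / (i : ℝ) ^ 2 * L := by
    rw [div_mul_eq_mul_div, le_div_iff₀ (by positivity)]
    refine le_of_mul_le_mul_right ?_ hε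
    nlinarith [mul_le_mul_of_nonneg_left hcos hB]
  linarith
end

section
/- For every δ > 0 there exists κ > 0 (depending only on δ) with the following property. Let d ≥ 1 be an integer, let a, b ∈ ℝ^d with a ≠ b, let ε ∈ (0, 1], and let P = (v₀, v₁, …, v_m) be a polygonal path with v₀ = a, v_m = b, v_{i−1} ≠ v_i for all i, which is monotone in direction ab, i.e. ⟨v_i − v_{i−1}, b − a⟩ ≥ 0 for all i. For α > 0 let F(α) denote the total weight of the edges v_{i−1}v_i whose undirected angle with the segment ab is at least α, and let ‖P‖ = ∑_{i=1}^m ‖v_i − v_{i−1}‖. If F(i·√(εκ)) ≤ ‖P‖/i^{2+δ} for every integer i with 1 ≤ i ≤ ⌈(π/2)/√(εκ)⌉, then ‖P‖ ≤ (1+ε)·‖b − a‖. -/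
open scoped RealInnerProductSpace

open Finset in
/-- A layer-cake bound for the square of `θ` in terms of the multiples of `s` below it. -/
lemma sq_le_sum_layers {θ s : ℝ} (hθ : 0 ≤ θ) (N : ℕ) (h : θ ≤ (N + 1) * s) :
    θ ^ 2 ≤ s ^ 2 *
      (1 + ∑ i ∈ range N, if ((i + 1 : ℕ) : ℝ) * s ≤ θ then 2 * (i : ℝ) + 3 else 0) := by
  induction N with
  | zero =>
    have : θ ≤ s := by simpa using h
    simpa using pow_le_pow_left₀ hθ this 2
  | succ N ih =>
    have hs : 0 ≤ s := by
      by_contra! hs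
      push_cast at h
      nlinarith [(Nat.cast_nonneg N : (0 : ℝ) ≤ N)]
    by_cases hN : θ ≤ (N + 1) * s
    · refine (ih hN).trans ?_
      rw [sum_range_succ]
      gcongr
      split_ifs
      · linarith [(by positivity : (0 : ℝ) ≤ 2 * (N : ℝ) + 3)]
      · linarith
    · push Not at hN
      have hsum : ∀ M : ℕ, ∑ i ∈ range M, (2 * (i : ℝ) + 3) = (M + 1) ^ 2 - 1 := by
        intro M
        induction M with
        | zero => simp
        | succ M ihM => rw [sum_range_succ, ihM]; push_cast; ring
      rw [sum_congr rfl (g := fun i : ℕ => 2 * (i : ℝ) + 3), hsum]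
      · calc θ ^ 2 ≤ (((N + 1 : ℕ) + 1) * s) ^ 2 := pow_le_pow_left₀ hθ h 2
          _ = _ := by ring
      · intro i hi
        have hiN : ((i + 1 : ℕ) : ℝ) ≤ N + 1 := by
          exact_mod_cast mem_range.mp hi
        exact if_pos ((mul_le_mul_of_nonneg_right hiN hs).trans hN.le)

lemma uangle_nonneg {d : ℕ} (u w : EuclideanSpace ℝ (Fin d)) : 0 ≤ uangle u w :=
  Real.arccos_nonneg _

lemma uangle_le_pi_div_two {d : ℕ} (u w : EuclideanSpace ℝ (Fin d)) :
    uangle u w ≤ Real.pi / 2 :=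
  Real.arccos_le_pi_div_two.mpr (by positivity)

lemma norm_mul_norm_mul_cos_uangle {d : ℕ} (u w : EuclideanSpace ℝ (Fin d)) :
    ‖u‖ * ‖w‖ * Real.cos (uangle u w) = |⟪u, w⟫| := by
  have hle := abs_real_inner_le_norm u w
  have h0 : 0 ≤ |⟪u, w⟫| / (‖u‖ * ‖w‖) := by positivity
  rw [uangle, Real.cos_arccos (by linarith) (div_le_one_of_le₀ hle (by positivity))]
  rcases eq_or_ne (‖u‖ * ‖w‖) 0 with h | h
  · rw [h] at hle ⊢
    linarith [abs_nonneg ⟪u, w⟫]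
  · exact mul_div_cancel₀ _ h

/-- The excess length of a monotone path is controlled by the squared angles of its edges. -/
lemma sum_norm_sub_le_sum_sq_uangle {d : ℕ} (m : ℕ) (v : ℕ → EuclideanSpace ℝ (Fin d))
    (hne : v 0 ≠ v m) (hmono : ∀ i < m, 0 ≤ ⟪v (i + 1) - v i, v m - v 0⟫) :
    ∑ j ∈ Finset.range m, ‖v (j + 1) - v j‖ - ‖v m - v 0‖ ≤
      (∑ j ∈ Finset.range m,
        ‖v (j + 1) - v j‖ * uangle (v (j + 1) - v j) (v m - v 0) ^ 2) / 2 := by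
  have hD : 0 < ‖v m - v 0‖ := norm_pos_iff.mpr (sub_ne_zero.mpr hne.symm)
  have hlen : ‖v m - v 0‖ = ∑ j ∈ Finset.range m,
      ‖v (j + 1) - v j‖ * Real.cos (uangle (v (j + 1) - v j) (v m - v 0)) := by
    apply mul_right_cancel₀ hD.ne'
    rw [← real_inner_self_eq_norm_mul_norm]
    conv_lhs => arg 2; rw [← Finset.sum_range_sub]
    rw [sum_inner, Finset.sum_mul]
    refine Finset.sum_congr rfl fun j hj => ?_
    rw [← abs_of_nonneg (hmono j (Finset.mem_range.mp hj)), ← norm_mul_norm_mul_cos_uangle]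
    ring
  nth_rewrite 1 [hlen]
  rw [← Finset.sum_sub_distrib, Finset.sum_div]
  refine Finset.sum_le_sum fun j _ => ?_
  have := mul_le_mul_of_nonneg_left
    (Real.one_sub_sq_div_two_le_cos (x := uangle (v (j + 1) - v j) (v m - v 0)))
    (norm_nonneg (v (j + 1) - v j))
  linarith

/-- If the weight of the elements with `θ j ≥ i s` decays like `1 / i ^ (2 + δ)`, then the
weighted second moment of `θ` is `O(s ^ 2)` times the total weight. -/
lemma sum_mul_sq_le_of_tail_le {ι : Type*} (t : Finset ι) (w θ : ι → ℝ) {s δ : ℝ} (N : ℕ)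
    (hδ : 0 < δ) (hw : ∀ j ∈ t, 0 ≤ w j) (hθ : ∀ j ∈ t, 0 ≤ θ j)
    (hN : ∀ j ∈ t, θ j ≤ (N + 1) * s)
    (htail : ∀ i < N, ∑ j ∈ t with ((i + 1 : ℕ) : ℝ) * s ≤ θ j, w j ≤
      (∑ j ∈ t, w j) / ((i + 1 : ℕ) : ℝ) ^ (2 + δ)) :
    ∑ j ∈ t, w j * θ j ^ 2 ≤
      s ^ 2 * (1 + 3 * ∑' n : ℕ, 1 / ((n + 1 : ℕ) : ℝ) ^ (1 + δ)) * ∑ j ∈ t, w j := by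
  have hsummable : Summable fun n : ℕ => 1 / ((n + 1 : ℕ) : ℝ) ^ (1 + δ) :=
    (summable_nat_add_iff 1).mpr (Real.summable_one_div_nat_rpow.mpr (by linarith))
  have hW : 0 ≤ ∑ j ∈ t, w j := Finset.sum_nonneg hw
  calc ∑ j ∈ t, w j * θ j ^ 2
      ≤ ∑ j ∈ t, w j * (s ^ 2 * (1 + ∑ i ∈ Finset.range N,
          if ((i + 1 : ℕ) : ℝ) * s ≤ θ j then 2 * (i : ℝ) + 3 else 0)) :=
        Finset.sum_le_sum fun j hj =>
          mul_le_mul_of_nonneg_left (sq_le_sum_layers (hθ j hj) N (hN j hj)) (hw j hj)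
    _ = s ^ 2 * (∑ j ∈ t, w j + ∑ i ∈ Finset.range N,
          (2 * (i : ℝ) + 3) * ∑ j ∈ t with ((i + 1 : ℕ) : ℝ) * s ≤ θ j, w j) := by
        simp_rw [Finset.sum_filter, Finset.mul_sum]
        rw [Finset.sum_comm, ← Finset.sum_add_distrib, Finset.mul_sum]
        refine Finset.sum_congr rfl fun j _ => ?_
        rw [mul_left_comm, mul_add, mul_one, Finset.mul_sum]
        congr 2
        refine Finset.sum_congr rfl fun i _ => ?_
        split_ifs <;> ring
    _ ≤ s ^ 2 * (∑ j ∈ t, w j + ∑ i ∈ Finset.range N,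
          3 * (1 / ((i + 1 : ℕ) : ℝ) ^ (1 + δ)) * ∑ j ∈ t, w j) := by
        refine mul_le_mul_of_nonneg_left
          (add_le_add le_rfl (Finset.sum_le_sum fun i hi => ?_)) (sq_nonneg s)
        have hi0 : (0 : ℝ) < ((i + 1 : ℕ) : ℝ) := by positivity
        have hpow : ((i + 1 : ℕ) : ℝ) ^ (2 + δ) =
            ((i + 1 : ℕ) : ℝ) * ((i + 1 : ℕ) : ℝ) ^ (1 + δ) := by
          rw [← Real.rpow_one_add' hi0.le (by linarith)]
          ring_nf
        have hpos : 0 < ((i + 1 : ℕ) : ℝ) ^ (1 + δ) := Real.rpow_pos_of_pos hi0 _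
        calc (2 * (i : ℝ) + 3) * ∑ j ∈ t with ((i + 1 : ℕ) : ℝ) * s ≤ θ j, w j
            ≤ (3 * ((i + 1 : ℕ) : ℝ)) *
                ((∑ j ∈ t, w j) / ((i + 1 : ℕ) : ℝ) ^ (2 + δ)) := by
              refine mul_le_mul ?_ (htail i (Finset.mem_range.mp hi)) ?_ (by positivity)
              · push_cast
                linarith [(Nat.cast_nonneg i : (0 : ℝ) ≤ i)]
              · exact Finset.sum_nonneg fun j hj => hw j (Finset.mem_filter.mp hj).1
          _ = 3 * (1 / ((i + 1 : ℕ) : ℝ) ^ (1 + δ)) * ∑ j ∈ t, w j := by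
              rw [hpow]
              field_simp
    _ = s ^ 2 * (1 + 3 * ∑ i ∈ Finset.range N, 1 / ((i + 1 : ℕ) : ℝ) ^ (1 + δ)) *
          ∑ j ∈ t, w j := by
        rw [← Finset.sum_mul, ← Finset.mul_sum]
        ring
    _ ≤ _ := by
        gcongr
        exact hsummable.sum_le_tsum _ fun n _ => by positivity

-- **Statement 2.** For every `δ > 0` there is a `κ > 0` such that: for any monotone
-- polygonal path `P` from `a` to `b` in `ℝ^d` and `ε ∈ (0,1]`, if for every integer
-- `1 ≤ i ≤ ⌈(π/2)/√(εκ)⌉` the total weight `F(i·√(εκ))` of the edges making undirected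
-- angle at least `i·√(εκ)` with `ab` is at most `‖P‖ / i^(2+δ)`, then
-- `‖P‖ ≤ (1+ε)·‖b − a‖`.
open Classical in
theorem monotone_path_short_of_small_angle_weight (δ : ℝ) (hδ : 0 < δ) :
    ∃ κ : ℝ, 0 < κ ∧
      ∀ (d : ℕ), 1 ≤ d → ∀ (a b : EuclideanSpace ℝ (Fin d)), a ≠ b →
      ∀ (ε : ℝ), 0 < ε → ε ≤ 1 →
      ∀ (m : ℕ) (v : ℕ → EuclideanSpace ℝ (Fin d)), v 0 = a → v m = b →
      (∀ i < m, v i ≠ v (i + 1)) →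
      (∀ i < m, 0 ≤ ⟪v (i + 1) - v i, b - a⟫) →
      (∀ i : ℕ, 1 ≤ i → i ≤ ⌈(Real.pi / 2) / Real.sqrt (ε * κ)⌉₊ →
        ∑ j ∈ (Finset.range m).filter
            (fun j => (i : ℝ) * Real.sqrt (ε * κ) ≤ uangle (v (j + 1) - v j) (b - a)),
          ‖v (j + 1) - v j‖ ≤
          (∑ j ∈ Finset.range m, ‖v (j + 1) - v j‖) / (i : ℝ) ^ ((2 : ℝ) + δ)) →
      ∑ j ∈ Finset.range m, ‖v (j + 1) - v j‖ ≤ (1 + ε) * ‖b - a‖ := by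
  set C : ℝ := ∑' n : ℕ, 1 / ((n + 1 : ℕ) : ℝ) ^ (1 + δ) with hC
  have hC0 : 0 ≤ C := tsum_nonneg fun n => by positivity
  refine ⟨1 / (1 + 3 * C), by positivity, ?_⟩
  rintro d - a b hab ε hε hε1 m v rfl rfl - hmono htail
  set s := Real.sqrt (ε * (1 / (1 + 3 * C))) with hs
  have hs2 : s ^ 2 * (1 + 3 * C) = ε := by
    rw [hs, Real.sq_sqrt (by positivity)]
    field_simp
  have hs0 : 0 < s := Real.sqrt_pos.mpr (by positivity)
  have hexcess := sum_norm_sub_le_sum_sq_uangle m v hab hmono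
  have hmoment := sum_mul_sq_le_of_tail_le (Finset.range m) (fun j => ‖v (j + 1) - v j‖)
    (fun j => uangle (v (j + 1) - v j) (v m - v 0)) (s := s) ⌈(Real.pi / 2) / s⌉₊ hδ
    (fun _ _ => norm_nonneg _) (fun _ _ => uangle_nonneg _ _)
    (fun j _ => by
      refine (uangle_le_pi_div_two _ _).trans ?_
      have := (div_le_iff₀ hs0).mp (Nat.le_ceil ((Real.pi / 2) / s))
      linarith)
    (fun i hi => by
      convert htail (i + 1) (by omega) hi)
  rw [← hC, hs2] at hmoment
  have hD := norm_nonneg (v m - v 0)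
  have hW : 0 ≤ ∑ j ∈ Finset.range m, ‖v (j + 1) - v j‖ :=
    Finset.sum_nonneg fun _ _ => norm_nonneg _
  have hshort : (1 - ε / 2) * ∑ j ∈ Finset.range m, ‖v (j + 1) - v j‖ ≤ ‖v m - v 0‖ := by
    linarith
  nlinarith [mul_le_mul_of_nonneg_left hshort (by linarith : 0 ≤ 1 + ε),
    mul_nonneg (mul_nonneg hε.le (sub_nonneg.mpr hε1)) hW]
end

section
/- Let d ≥ 2 be an integer. There exists a constant c_d > 0, depending only on d, such that for every ε with 0 < ε < (8d)^{−2} the following holds. Let ρ = ⌈1/(8d·√ε)⌉, and let S = S₀ ∪ S₁ where S₀ = (ρ^{−1}·ℤ^d) ∩ ([0,1]^{d−1} × {0}) and S₁ = (ρ^{−1}·ℤ^d) ∩ ([0,1]^{d−1} × {1}). Then every Euclidean Steiner (1+ε)-spanner N = (V, E) for S has total weight ∑_{{u,v} ∈ E} ‖u − v‖ ≥ c_d · ε^{1−d}. -/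
open scoped RealInnerProductSpace

noncomputable section

/-- The Euclidean length of an (unordered) edge. -/
noncomputable def edgeLen {d : ℕ} (e : Sym2 (EuclideanSpace ℝ (Fin d))) : ℝ :=
  Sym2.lift ⟨fun a b => ‖a - b‖, fun a b => norm_sub_rev a b⟩ e

/-- The grid `(ρ⁻¹·ℤ^d) ∩ ([0,1]^{d-1} × {c})`: all coordinates are integer multiples of
`ρ⁻¹`, the first `d-1` coordinates lie in `[0,1]`, and the last coordinate equals `c`. -/
def gridSet (d : ℕ) (ρ : ℕ) (c : ℝ) : Set (EuclideanSpace ℝ (Fin d)) :=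
  {p | ∀ i : Fin d, (∃ z : ℤ, p i = (z : ℝ) / (ρ : ℝ)) ∧
      ((i : ℕ) < d - 1 → 0 ≤ p i ∧ p i ≤ 1) ∧ ((i : ℕ) = d - 1 → p i = c)}

/-- `N = (V, E)` is a Euclidean Steiner `(1+ε)`-spanner for `S`: `S ⊆ V`, the edges are
unordered pairs of distinct points of `V`, and every pair of points of `S` is connected by
a path of weight at most `(1+ε)` times their distance. -/
def IsSteinerSpanner {d : ℕ} (ε : ℝ) (S : Set (EuclideanSpace ℝ (Fin d)))
    (V : Finset (EuclideanSpace ℝ (Fin d)))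
    (E : Finset (Sym2 (EuclideanSpace ℝ (Fin d)))) : Prop :=
  S ⊆ ↑V ∧
  (∀ e ∈ E, ¬ e.IsDiag ∧ ∀ p ∈ e, p ∈ V) ∧
  ∀ a ∈ S, ∀ b ∈ S, ∃ (m : ℕ) (v : ℕ → EuclideanSpace ℝ (Fin d)),
    v 0 = a ∧ v m = b ∧ (∀ i < m, s(v i, v (i + 1)) ∈ E) ∧
    ∑ i ∈ Finset.range m, ‖v (i + 1) - v i‖ ≤ (1 + ε) * ‖a - b‖

section InnerProductSpace

variable {H : Type*} [NormedAddCommGroup H] [InnerProductSpace ℝ H]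

/-- The vector `w` makes a small angle with `p`: the cosine is at least `1 - 3ε/2`. -/
def NearlyAligned (ε : ℝ) (w p : H) : Prop :=
  ‖w‖ * ‖p‖ * (1 - 3 / 2 * ε) ≤ ⟪w, p⟫

/-- Comparison of the angle between `p` and `q` with their distance, when both lie on the
hyperplane at distance one from the origin. -/
lemma norm_sub_sq_le_gram {n p q : H} (hn : ‖n‖ = 1) (hp : ⟪n, p⟫ = 1) (hq : ⟪n, q⟫ = 1) :
    ‖p - q‖ ^ 2 ≤ ‖p‖ ^ 2 * ‖q‖ ^ 2 - ⟪p, q⟫ ^ 2 := by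
  have hcs := real_inner_mul_inner_self_le (p - n) (q - n)
  have hnn : ⟪n, n⟫ = 1 := by rw [real_inner_self_eq_norm_sq, hn]; norm_num
  rw [norm_sub_sq_real, ← real_inner_self_eq_norm_sq, ← real_inner_self_eq_norm_sq]
  simp only [inner_sub_left, inner_sub_right, hp, hq, hnn, real_inner_comm n p,
    real_inner_comm n q] at hcs ⊢
  nlinarith [hcs]

/-- Distance between parallel lines, compared with the length of a horizontal offset. -/
lemma norm_sq_le_gram {n p g : H} (hn : ‖n‖ = 1) (hp : ⟪n, p⟫ = 1) (hg : ⟪n, g⟫ = 0) :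
    ‖g‖ ^ 2 ≤ ‖g‖ ^ 2 * ‖p‖ ^ 2 - ⟪g, p⟫ ^ 2 := by
  have hcs := real_inner_mul_inner_self_le g (p - n)
  have hnn : ⟪n, n⟫ = 1 := by rw [real_inner_self_eq_norm_sq, hn]; norm_num
  rw [← real_inner_self_eq_norm_sq, ← real_inner_self_eq_norm_sq]
  simp only [inner_sub_left, inner_sub_right, hnn] at hcs
  rw [real_inner_comm n p, real_inner_comm n g, hp, hg] at hcs
  nlinarith [hcs]

lemma NearlyAligned.norm_normalize_sub_sq_le {ε : ℝ} {w p : H} (h : NearlyAligned ε w p)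
    (hw : w ≠ 0) (hp : p ≠ 0) : ‖‖w‖⁻¹ • w - ‖p‖⁻¹ • p‖ ^ 2 ≤ 3 * ε := by
  have hw' : 0 < ‖w‖ := norm_pos_iff.2 hw
  have hp' : 0 < ‖p‖ := norm_pos_iff.2 hp
  rw [norm_sub_sq_real, norm_smul, norm_smul, norm_inv, norm_inv, norm_norm, norm_norm,
    inv_mul_cancel₀ hw'.ne', inv_mul_cancel₀ hp'.ne', real_inner_smul_left,
    real_inner_smul_right]
  have h2 : 1 - 3 / 2 * ε ≤ ‖w‖⁻¹ * (‖p‖⁻¹ * ⟪w, p⟫) := by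
    rw [← mul_assoc, ← mul_inv, inv_mul_eq_div, le_div_iff₀ (mul_pos hw' hp'), mul_comm]
    exact h
  linarith

/-- A vector nearly aligned with a vector pointing upwards points upwards. -/
lemma NearlyAligned.inner_pos {ε D : ℝ} {n w p : H} (h : NearlyAligned ε w p) (hw : w ≠ 0)
    (hn : ‖n‖ = 1) (hp : ⟪n, p⟫ = 1) (hpD : ‖p‖ ^ 2 ≤ D) (hD : 3 * ε * D < 1) (hε : 0 < ε) :
    0 < ⟪n, w⟫ := by
  have hp0 : p ≠ 0 := by rintro rfl; simp at hp
  have hp' : 0 < ‖p‖ := norm_pos_iff.2 hp0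
  have hw' : 0 < ‖w‖ := norm_pos_iff.2 hw
  have hd := h.norm_normalize_sub_sq_le hw hp0
  have hcs := abs_real_inner_le_norm n (‖w‖⁻¹ • w - ‖p‖⁻¹ • p)
  rw [hn, one_mul, inner_sub_right, real_inner_smul_right, real_inner_smul_right, hp,
    mul_one] at hcs
  set δ := ‖‖w‖⁻¹ • w - ‖p‖⁻¹ • p‖ with hδ
  have hlt : δ < ‖p‖⁻¹ := by
    refine lt_of_pow_lt_pow_left₀ 2 (by positivity) (hd.trans_lt ?_)
    rw [inv_pow, lt_inv_comm₀ (by positivity) (by positivity), ← one_div,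
      lt_div_iff₀ (by positivity)]
    nlinarith
  have : 0 < ‖w‖⁻¹ * ⟪n, w⟫ := by linarith [(abs_le.1 hcs).1]
  exact pos_of_mul_pos_right this (by positivity)

/-- Two vectors at height one that are nearly aligned with a common vector are close. -/
lemma NearlyAligned.norm_sub_sq_le {ε D : ℝ} {n w p q : H} (hwp : NearlyAligned ε w p)
    (hwq : NearlyAligned ε w q) (hw : w ≠ 0) (hn : ‖n‖ = 1) (hp : ⟪n, p⟫ = 1)
    (hq : ⟪n, q⟫ = 1) (hpD : ‖p‖ ^ 2 ≤ D) (hqD : ‖q‖ ^ 2 ≤ D) (hε : 0 < ε) :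
    ‖p - q‖ ^ 2 ≤ 12 * ε * D ^ 2 := by
  have hp0 : p ≠ 0 := by rintro rfl; simp at hp
  have hq0 : q ≠ 0 := by rintro rfl; simp at hq
  have hp' : 0 < ‖p‖ := norm_pos_iff.2 hp0
  have hq' : 0 < ‖q‖ := norm_pos_iff.2 hq0
  have h1 := hwp.norm_normalize_sub_sq_le hw hp0
  have h2 := hwq.norm_normalize_sub_sq_le hw hq0
  have hpar := parallelogram_law_with_norm ℝ (‖w‖⁻¹ • w - ‖p‖⁻¹ • p) (‖w‖⁻¹ • w - ‖q‖⁻¹ • q)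
  rw [sub_sub_sub_cancel_left] at hpar
  have h3 : ‖‖q‖⁻¹ • q - ‖p‖⁻¹ • p‖ ^ 2 ≤ 12 * ε := by
    nlinarith [mul_self_nonneg ‖‖w‖⁻¹ • w - ‖p‖⁻¹ • p + (‖w‖⁻¹ • w - ‖q‖⁻¹ • q)‖]
  rw [norm_sub_sq_real, norm_smul, norm_smul, norm_inv, norm_inv, norm_norm, norm_norm,
    inv_mul_cancel₀ hq'.ne', inv_mul_cancel₀ hp'.ne', real_inner_smul_left,
    real_inner_smul_right, real_inner_comm] at h3
  set x := ⟪p, q⟫ with hx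
  have h4 : ‖p‖ * ‖q‖ - x ≤ 6 * ε * (‖p‖ * ‖q‖) := by
    have h5 : ‖q‖⁻¹ * (‖p‖⁻¹ * x) * (‖p‖ * ‖q‖) = x := by field_simp
    nlinarith [mul_pos hp' hq']
  have h6 : x ≤ ‖p‖ * ‖q‖ := real_inner_le_norm p q
  have h7 := norm_sub_sq_le_gram hn hp hq
  have h8 : 0 ≤ ‖p‖ * ‖q‖ + x := by
    linarith [(abs_le.1 (abs_real_inner_le_norm p q)).1]
  have h9 : (‖p‖ * ‖q‖) ^ 2 ≤ D ^ 2 := by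
    rw [mul_pow, sq D]; gcongr; exact (sq_nonneg _).trans hpD
  calc ‖p - q‖ ^ 2 ≤ (‖p‖ * ‖q‖ - x) * (‖p‖ * ‖q‖ + x) := by linarith
    _ ≤ 6 * ε * (‖p‖ * ‖q‖) * (2 * (‖p‖ * ‖q‖)) := by gcongr; linarith
    _ = 12 * ε * (‖p‖ * ‖q‖) ^ 2 := by ring
    _ ≤ 12 * ε * D ^ 2 := by gcongr

/-- A point of an ellipsoid with foci `0` and `p` is close to the axis of the ellipsoid. -/
lemma gram_le_of_norm_add_norm_le {ε : ℝ} {x p : H}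
    (h : ‖x‖ + ‖p - x‖ ≤ (1 + ε) * ‖p‖) :
    4 * (‖x‖ ^ 2 * ‖p‖ ^ 2 - ⟪x, p⟫ ^ 2) ≤ (2 * ε + ε ^ 2) * (‖p‖ ^ 2) ^ 2 := by
  have hy : ‖p - x‖ ^ 2 = ‖p‖ ^ 2 - 2 * ⟪x, p⟫ + ‖x‖ ^ 2 := by
    rw [norm_sub_sq_real, real_inner_comm]
  have hX : 0 ≤ ‖x‖ ^ 2 * ‖p‖ ^ 2 - ⟪x, p⟫ ^ 2 := by
    have := real_inner_mul_inner_self_le x p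
    simp only [real_inner_self_eq_norm_sq] at this
    nlinarith
  have hA := norm_nonneg x
  have hB := norm_nonneg (p - x)
  have hL := norm_nonneg p
  set A := ‖x‖
  set B := ‖p - x‖
  set L := ‖p‖
  set s := ⟪x, p⟫
  have hAB : s * (L ^ 2 - s) + (A ^ 2 * L ^ 2 - s ^ 2) ≤ A * B * L ^ 2 := by
    refine le_of_sq_le_sq ?_ (by positivity)
    have : (A * B * L ^ 2) ^ 2 = A ^ 2 * L ^ 2 * (L ^ 2 * B ^ 2) := by ring
    rw [this, hy]
    nlinarith [mul_nonneg hX (sq_nonneg (2 * s - L ^ 2))]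
  have hsq : (A + B) ^ 2 ≤ ((1 + ε) * L) ^ 2 := by gcongr
  have := mul_le_mul_of_nonneg_right hsq (sq_nonneg L)
  nlinarith

/-- Two ellipsoids whose foci are translates of each other by `a' - a` and which share a point. -/
lemma norm_sub_sq_le_of_common_point {ε D : ℝ} {n p a a' u : H} (hn : ‖n‖ = 1)
    (hp : ⟪n, p⟫ = 1) (ha : ⟪n, a' - a⟫ = 0) (hpD : ‖p‖ ^ 2 ≤ D) (hε : 0 < ε)
    (h : ‖u - a‖ + ‖p - (u - a)‖ ≤ (1 + ε) * ‖p‖)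
    (h' : ‖u - a'‖ + ‖p - (u - a')‖ ≤ (1 + ε) * ‖p‖) :
    ‖a' - a‖ ^ 2 ≤ (2 * ε + ε ^ 2) * D ^ 2 := by
  have h1 := gram_le_of_norm_add_norm_le h
  have h2 := gram_le_of_norm_add_norm_le h'
  have h3 := norm_sq_le_gram hn hp ha
  have hg : a' - a = (u - a) - (u - a') := by abel
  have hsum : 0 ≤ ‖(u - a) + (u - a')‖ ^ 2 * ‖p‖ ^ 2 - ⟪(u - a) + (u - a'), p⟫ ^ 2 := by
    have := real_inner_mul_inner_self_le ((u - a) + (u - a')) p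
    simp only [real_inner_self_eq_norm_sq] at this
    nlinarith
  have h4 : (‖p‖ ^ 2) ^ 2 ≤ D ^ 2 := by gcongr
  rw [norm_add_sq_real, inner_add_left] at hsum
  have h5 : ‖a' - a‖ ^ 2 ≤ (2 * ε + ε ^ 2) * (‖p‖ ^ 2) ^ 2 := by
    refine h3.trans ?_
    rw [hg, norm_sub_sq_real, inner_sub_left (u - a) (u - a') p]
    nlinarith
  exact h5.trans (by gcongr)

/-- In a path of length at most `1 + ε` times the distance between its ends, the steps that are
nearly aligned with the segment between the ends carry a third of the length. -/
lemma third_le_sum_nearlyAligned {ε : ℝ} (hε : 0 < ε) (m : ℕ) (v : ℕ → H) {p : H}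
    (hvp : v m - v 0 = p) [DecidablePred fun i => NearlyAligned ε (v (i + 1) - v i) p]
    (h : ∑ i ∈ Finset.range m, ‖v (i + 1) - v i‖ ≤ (1 + ε) * ‖p‖) :
    ‖p‖ / 3 ≤ ∑ i ∈ (Finset.range m).filter
      (fun i => NearlyAligned ε (v (i + 1) - v i) p), ‖v (i + 1) - v i‖ := by
  have htel := (Finset.sum_range_sub v m).trans hvp
  rcases (norm_nonneg p).eq_or_lt with hp | hp
  · rw [← hp, zero_div]; positivity
  have hsplit := Finset.sum_filter_add_sum_filter_not (Finset.range m)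
    (fun i => NearlyAligned ε (v (i + 1) - v i) p) (fun i => ‖v (i + 1) - v i‖)
  have hlow : ‖p‖ ≤ ∑ i ∈ Finset.range m, ‖v (i + 1) - v i‖ := by
    rw [← htel]; exact norm_sum_le _ _
  have hexc : ∑ i ∈ Finset.range m, (‖v (i + 1) - v i‖ * ‖p‖ - ⟪v (i + 1) - v i, p⟫)
      ≤ ε * ‖p‖ ^ 2 := by
    rw [Finset.sum_sub_distrib, ← Finset.sum_mul, ← sum_inner, htel,
      real_inner_self_eq_norm_sq]
    nlinarith
  have hbad : ∑ i ∈ (Finset.range m).filter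
      (fun i => ¬ NearlyAligned ε (v (i + 1) - v i) p),
        3 / 2 * ε * ‖p‖ * ‖v (i + 1) - v i‖ ≤ ε * ‖p‖ ^ 2 := by
    refine (Finset.sum_le_sum fun i hi => ?_).trans ((Finset.sum_le_sum_of_subset_of_nonneg
      (Finset.filter_subset _ _) fun i _ _ => ?_).trans hexc)
    · have := (Finset.mem_filter.1 hi).2
      rw [NearlyAligned, not_le] at this
      linarith
    · exact sub_nonneg.2 (real_inner_le_norm _ _)
  rw [← Finset.mul_sum] at hbad
  have hpos : 0 < ε * ‖p‖ := by positivity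
  have : 3 / 2 * ∑ i ∈ (Finset.range m).filter
      (fun i => ¬ NearlyAligned ε (v (i + 1) - v i) p), ‖v (i + 1) - v i‖ ≤ ‖p‖ := by
    refine le_of_mul_le_mul_left ?_ hpos
    linarith
  linarith

end InnerProductSpace

section Path

variable {H : Type*} [NormedAddCommGroup H]

/-- A vertex of a path is on the ellipsoid determined by the length of the path. -/
lemma norm_add_norm_le_sum (m : ℕ) (v : ℕ → H) {i : ℕ} (hi : i ≤ m) :
    ‖v i - v 0‖ + ‖v m - v i‖ ≤ ∑ k ∈ Finset.range m, ‖v (k + 1) - v k‖ := by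
  rw [← Finset.sum_range_add_sum_Ico _ hi, ← Finset.sum_range_sub v i,
    ← Finset.sum_Ico_sub v hi]
  exact add_le_add (norm_sum_le _ _) (norm_sum_le _ _)

/-- Cutting the closed part of a walk between two visits of the same vertex. -/
lemma exists_shorter_walk {E : Finset (Sym2 H)} {m : ℕ} {v : ℕ → H}
    (hE : ∀ i < m, s(v i, v (i + 1)) ∈ E) {i j : ℕ} (hij : i < j) (hj : j ≤ m)
    (hv : v i = v j) :
    ∃ (m' : ℕ) (v' : ℕ → H), m' < m ∧ v' 0 = v 0 ∧ v' m' = v m ∧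
      (∀ i < m', s(v' i, v' (i + 1)) ∈ E) ∧
      ∑ k ∈ Finset.range m', ‖v' (k + 1) - v' k‖ ≤
        ∑ k ∈ Finset.range m, ‖v (k + 1) - v k‖ := by
  obtain ⟨r, rfl⟩ := Nat.exists_eq_add_of_le hj
  let v' : ℕ → H := fun k => if k ≤ i then v k else v (k - i + j)
  have hlow : ∀ k ≤ i, v' k = v k := fun k hk => if_pos hk
  have hhigh : ∀ k, v' (i + k) = v (j + k) := by
    intro k
    rcases Nat.eq_zero_or_pos k with rfl | hk
    · simpa using (hlow i le_rfl).trans hv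
    · have : ¬ i + k ≤ i := by omega
      simp only [v', if_neg this]
      congr 1; omega
  refine ⟨i + r, v', by omega, hlow 0 (Nat.zero_le _), hhigh r, fun k hk => ?_, ?_⟩
  · rcases lt_or_ge k i with h | h
    · rw [hlow k h.le, hlow (k + 1) h]; exact hE k (by omega)
    · obtain ⟨l, rfl⟩ := Nat.exists_eq_add_of_le h
      rw [hhigh, add_assoc, hhigh, ← add_assoc]; exact hE _ (by omega)
  · rw [Finset.sum_range_add, Finset.sum_range_add]
    refine add_le_add ?_ (le_of_eq ?_)
    · refine le_trans (le_of_eq (Finset.sum_congr rfl fun k hk => ?_))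
        (Finset.sum_le_sum_of_subset_of_nonneg (Finset.range_mono hij.le)
          fun _ _ _ => norm_nonneg _)
      have := Finset.mem_range.1 hk
      rw [hlow k this.le, hlow (k + 1) this]
    · refine Finset.sum_congr rfl fun k _ => ?_
      rw [hhigh, add_assoc, hhigh, ← add_assoc]

/-- Every walk can be shortened to one without repeated edges. -/
lemma exists_walk_injOn_edges {E : Finset (Sym2 H)} {m : ℕ} {v : ℕ → H}
    (hE : ∀ i < m, s(v i, v (i + 1)) ∈ E) :
    ∃ (m' : ℕ) (v' : ℕ → H), v' 0 = v 0 ∧ v' m' = v m ∧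
      (∀ i < m', s(v' i, v' (i + 1)) ∈ E) ∧
      ∑ k ∈ Finset.range m', ‖v' (k + 1) - v' k‖ ≤
        ∑ k ∈ Finset.range m, ‖v (k + 1) - v k‖ ∧
      Set.InjOn (fun i => s(v' i, v' (i + 1))) (Finset.range m') := by
  induction m using Nat.strong_induction_on generalizing v with
  | _ m ih =>
    by_cases hrep : ∃ i j, i < j ∧ j ≤ m ∧ v i = v j
    · obtain ⟨i, j, hij, hj, hv⟩ := hrep
      obtain ⟨m₁, v₁, hm, h0, hm₁, hE₁, hs⟩ := exists_shorter_walk hE hij hj hv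
      obtain ⟨m₂, v₂, h0', hm₂, hE₂, hs', hinj⟩ := ih m₁ hm hE₁
      exact ⟨m₂, v₂, h0'.trans h0, hm₂.trans hm₁, hE₂, hs'.trans hs, hinj⟩
    · push Not at hrep
      refine ⟨m, v, rfl, rfl, hE, le_rfl, ?_⟩
      have key : ∀ i j, i < j → j < m → s(v i, v (i + 1)) ≠ s(v j, v (j + 1)) := by
        intro i j hij hj h
        rcases Sym2.eq_iff.1 h with h | h
        · exact hrep i j hij hj.le h.1
        · exact hrep i (j + 1) (by omega) hj h.1
      intro i hi j hj h
      simp only [Finset.coe_range, Set.mem_Iio] at hi hj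
      rcases lt_trichotomy i j with hij | hij | hij
      · exact (key i j hij hj h).elim
      · exact hij
      · exact (key j i hij hi h.symm).elim

end Path

section Edges

variable {d : ℕ}

/-- The edge `e` can be traversed from a point `u` of the ellipsoid with foci `a` and `b`, nearly
in the direction of `b - a`. -/
def IsGoodEdge (ε : ℝ) (a b : EuclideanSpace ℝ (Fin d))
    (e : Sym2 (EuclideanSpace ℝ (Fin d))) : Prop :=
  ∃ u u', e = s(u, u') ∧ u' - u ≠ 0 ∧ NearlyAligned ε (u' - u) (b - a) ∧
    ‖u - a‖ + ‖(b - a) - (u - a)‖ ≤ (1 + ε) * ‖b - a‖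

lemma edgeLen_nonneg (e : Sym2 (EuclideanSpace ℝ (Fin d))) : 0 ≤ edgeLen e := by
  induction e with
  | _ x y => exact norm_nonneg (x - y)

lemma IsSteinerSpanner.third_le_sum_goodEdge {ε : ℝ} (hε : 0 < ε)
    {S : Set (EuclideanSpace ℝ (Fin d))} {V : Finset (EuclideanSpace ℝ (Fin d))}
    {E : Finset (Sym2 (EuclideanSpace ℝ (Fin d)))} (hN : IsSteinerSpanner ε S V E)
    {a b : EuclideanSpace ℝ (Fin d)} (ha : a ∈ S) (hb : b ∈ S)
    [DecidablePred (IsGoodEdge ε a b)] :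
    ‖b - a‖ / 3 ≤ ∑ e ∈ E.filter (IsGoodEdge ε a b), edgeLen e := by
  classical
  obtain ⟨-, hE, hpath⟩ := hN
  obtain ⟨m₁, v₁, h0, hm, hvE, hsum⟩ := hpath a ha b hb
  obtain ⟨m, v, h0', hm', hvE', hsum', hinj⟩ := exists_walk_injOn_edges hvE
  rw [norm_sub_rev] at hsum
  obtain rfl : v 0 = a := h0'.trans h0
  obtain rfl : v m = b := hm'.trans hm
  have hlen := hsum'.trans hsum
  refine (third_le_sum_nearlyAligned hε m v rfl hlen).trans ?_
  change ∑ i ∈ _, edgeLen s(v (i + 1), v i) ≤ _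
  rw [← Finset.sum_image (f := edgeLen) (g := fun i => s(v (i + 1), v i)) ?_]
  · refine Finset.sum_le_sum_of_subset_of_nonneg ?_ fun _ _ _ => edgeLen_nonneg _
    intro e he
    obtain ⟨i, hi, rfl⟩ := Finset.mem_image.1 he
    obtain ⟨hi, hal⟩ := Finset.mem_filter.1 hi
    have him := Finset.mem_range.1 hi
    have hmem := hvE' i him
    rw [Sym2.eq_swap] at hmem
    refine Finset.mem_filter.2 ⟨hmem, v i, v (i + 1), Sym2.eq_swap, ?_, hal, ?_⟩
    · exact sub_ne_zero.2 fun h => (hE _ hmem).1 (by simpa using h)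
    · rw [sub_sub_sub_cancel_right]
      exact (norm_add_norm_le_sum m v him.le).trans hlen
  · intro i hi j hj h
    refine hinj (Finset.filter_subset _ _ hi) (Finset.filter_subset _ _ hj) ?_
    simpa only [Sym2.eq_swap] using h

/-- An edge that is good for two pairs of points at unit height difference forces the pairs to be
close to each other. -/
lemma IsGoodEdge.close {ε D : ℝ} (hε : 0 < ε) (hD : 3 * ε * D < 1)
    {n a b a' b' : EuclideanSpace ℝ (Fin d)} {e : Sym2 (EuclideanSpace ℝ (Fin d))}
    (h : IsGoodEdge ε a b e) (h' : IsGoodEdge ε a' b' e) (hn : ‖n‖ = 1)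
    (hb : ⟪n, b - a⟫ = 1) (hb' : ⟪n, b' - a'⟫ = 1) (ha : ⟪n, a' - a⟫ = 0)
    (hL : ‖b - a‖ ^ 2 ≤ D) (hL' : ‖b' - a'‖ ^ 2 ≤ D) :
    ‖(b - a) - (b' - a')‖ ^ 2 ≤ 12 * ε * D ^ 2 ∧
      (b - a = b' - a' → ‖a' - a‖ ^ 2 ≤ (2 * ε + ε ^ 2) * D ^ 2) := by
  obtain ⟨u, w, rfl, hw, hal, hell⟩ := h
  obtain ⟨u', w', he, hw', hal', hell'⟩ := h'
  have hpos := hal.inner_pos hw hn hb hL hD hε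
  have hpos' := hal'.inner_pos hw' hn hb' hL' hD hε
  rcases Sym2.eq_iff.1 he with ⟨rfl, rfl⟩ | ⟨rfl, rfl⟩
  · refine ⟨hal.norm_sub_sq_le hal' hw hn hb hb' hL hL' hε, fun heq => ?_⟩
    rw [← heq] at hell'
    exact norm_sub_sq_le_of_common_point hn hb ha hL hε hell hell'
  · rw [← neg_sub, inner_neg_right] at hpos
    linarith

end Edges

section Grid

variable {d ρ : ℕ}

/-- The grid point with numerators `k` and last coordinate `c`. -/
def gridPoint (d ρ : ℕ) (k : Fin (d - 1) → Fin ρ) (c : ℝ) : EuclideanSpace ℝ (Fin d) :=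
  WithLp.toLp 2 fun i => if h : (i : ℕ) < d - 1 then ((k ⟨i, h⟩ : ℕ) : ℝ) / ρ else c

lemma gridPoint_of_lt (k : Fin (d - 1) → Fin ρ) (c : ℝ) (i : Fin d) (h : (i : ℕ) < d - 1) :
    gridPoint d ρ k c i = ((k ⟨i, h⟩ : ℕ) : ℝ) / ρ := by
  simp [gridPoint, h]

lemma gridPoint_of_not_lt (k : Fin (d - 1) → Fin ρ) (c : ℝ) (i : Fin d)
    (h : ¬ (i : ℕ) < d - 1) : gridPoint d ρ k c i = c := by
  simp [gridPoint, h]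

lemma gridPoint_mem_Icc (k : Fin (d - 1) → Fin ρ) (c : ℝ) (i : Fin d) (h : (i : ℕ) < d - 1) :
    gridPoint d ρ k c i ∈ Set.Icc (0 : ℝ) 1 := by
  rw [gridPoint_of_lt k c i h]
  exact ⟨by positivity, div_le_one_of_le₀ (by exact_mod_cast (k ⟨i, h⟩).2.le) (by positivity)⟩

lemma gridPoint_mem_gridSet (k : Fin (d - 1) → Fin ρ) {c : ℝ} (hc : ∃ z : ℤ, c = z / ρ) :
    gridPoint d ρ k c ∈ gridSet d ρ c := by
  intro i
  by_cases h : (i : ℕ) < d - 1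
  · refine ⟨⟨(k ⟨i, h⟩ : ℕ), ?_⟩, fun _ => gridPoint_mem_Icc k c i h, fun h' => by omega⟩
    rw [gridPoint_of_lt k c i h, Int.cast_natCast]
  · rw [gridPoint_of_not_lt k c i h]
    exact ⟨hc, fun h' => (h h').elim, fun _ => rfl⟩

lemma gridPoint_injective (hρ : 0 < ρ) (c : ℝ) :
    Function.Injective fun k => gridPoint d ρ k c := by
  intro k l h
  ext ⟨i, hi⟩
  have hd : i < d := by omega
  have := congrArg (fun p : EuclideanSpace ℝ (Fin d) => p ⟨i, hd⟩) h
  simp only [gridPoint_of_lt _ c ⟨i, hd⟩ hi] at this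
  have hρ' : (ρ : ℝ) ≠ 0 := by positivity
  exact_mod_cast (div_left_inj' hρ').1 this

lemma norm_sq_gridPoint_sub_le (k l : Fin (d - 1) → Fin ρ) :
    ‖gridPoint d ρ l 1 - gridPoint d ρ k 0‖ ^ 2 ≤ d := by
  rw [EuclideanSpace.norm_sq_eq]
  refine (Finset.sum_le_card_nsmul _ _ 1 fun i _ => ?_).trans (by simp)
  rw [PiLp.sub_apply, Real.norm_eq_abs, sq_abs, sq_le_one_iff_abs_le_one, abs_le]
  by_cases h : (i : ℕ) < d - 1
  · have h1 := gridPoint_mem_Icc k 0 i h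
    have h2 := gridPoint_mem_Icc l 1 i h
    constructor <;> linarith [h1.1, h1.2, h2.1, h2.2]
  · simp [gridPoint_of_not_lt _ _ i h]

/-- A nonzero vector with coordinates in `ρ⁻¹ℤ` has length at least `ρ⁻¹`. -/
lemma inv_sq_le_norm_sq (hρ : 0 < ρ) {p : EuclideanSpace ℝ (Fin d)} (hp : p ≠ 0)
    (hz : ∀ i, ∃ z : ℤ, p i = z / ρ) : ((ρ : ℝ) ^ 2)⁻¹ ≤ ‖p‖ ^ 2 := by
  obtain ⟨i, hi⟩ : ∃ i, p i ≠ 0 := by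
    by_contra! h
    exact hp (by ext i; simpa using h i)
  obtain ⟨z, hz⟩ := hz i
  have hz0 : z ≠ 0 := by rintro rfl; simp [hz] at hi
  have h1 : (1 : ℝ) ≤ (z : ℝ) ^ 2 := by
    have : (1 : ℤ) ≤ z ^ 2 := by have := sq_pos_of_ne_zero hz0; omega
    exact_mod_cast this
  have h2 : ‖p i‖ ^ 2 ≤ ‖p‖ ^ 2 := by gcongr; exact PiLp.norm_apply_le p i
  refine le_trans ?_ h2
  rw [hz, Real.norm_eq_abs, sq_abs, div_pow, ← one_div]
  gcongr

lemma exists_int_sub {x y : ℝ} (hx : ∃ z : ℤ, x = z / ρ) (hy : ∃ z : ℤ, y = z / ρ) :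
    ∃ z : ℤ, x - y = z / ρ := by
  obtain ⟨z, rfl⟩ := hx
  obtain ⟨w, rfl⟩ := hy
  exact ⟨z - w, by push_cast; ring⟩

/-- No edge is good for two different pairs of grid points. -/
lemma eq_of_isGoodEdge {ε : ℝ} (hd : 2 ≤ d) (hε : 0 < ε) (hεd : ε < ((8 * (d : ℝ)) ^ 2)⁻¹)
    (hρ : 0 < ρ) (hρε : 16 * ε * (d : ℝ) ^ 2 < ((ρ : ℝ) ^ 2)⁻¹)
    {k l k' l' : Fin (d - 1) → Fin ρ} {e : Sym2 (EuclideanSpace ℝ (Fin d))}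
    (h : IsGoodEdge ε (gridPoint d ρ k 0) (gridPoint d ρ l 1) e)
    (h' : IsGoodEdge ε (gridPoint d ρ k' 0) (gridPoint d ρ l' 1) e) : (k, l) = (k', l') := by
  have hd' : (2 : ℝ) ≤ d := by exact_mod_cast hd
  have hlast : d - 1 < d := by omega
  set n : EuclideanSpace ℝ (Fin d) := EuclideanSpace.single ⟨d - 1, hlast⟩ 1 with hn
  have hinner : ∀ p : EuclideanSpace ℝ (Fin d), ⟪n, p⟫ = p ⟨d - 1, hlast⟩ := by
    intro p; simp [hn, EuclideanSpace.inner_single_left]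
  have hlastc : ∀ (k : Fin (d - 1) → Fin ρ) c, gridPoint d ρ k c ⟨d - 1, hlast⟩ = c :=
    fun k c => gridPoint_of_not_lt k c _ (lt_irrefl _)
  have hεd' : 64 * ε * (d : ℝ) ^ 2 < 1 := by
    rw [lt_inv_comm₀ hε (by positivity), ← one_div, lt_div_iff₀ hε] at hεd
    linarith
  have hdd : (d : ℝ) ≤ (d : ℝ) ^ 2 := by nlinarith
  have hD : 3 * ε * (d : ℝ) < 1 := by nlinarith
  have hρ' : (ρ : ℝ) ≠ 0 := by positivity
  have h0 : ∀ k : Fin (d - 1) → Fin ρ, ∀ i, ∃ z : ℤ, gridPoint d ρ k 0 i = z / ρ :=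
    fun k i => (gridPoint_mem_gridSet k ⟨0, by simp⟩ i).1
  have h1 : ∀ k : Fin (d - 1) → Fin ρ, ∀ i, ∃ z : ℤ, gridPoint d ρ k 1 i = z / ρ :=
    fun k i => (gridPoint_mem_gridSet k ⟨ρ, by simp [hρ']⟩ i).1
  obtain ⟨hclose, hpar⟩ := h.close hε hD h' (n := n) (by simp [hn])
    (by simp [hinner, hlastc]) (by simp [hinner, hlastc]) (by simp [hinner, hlastc])
    (norm_sq_gridPoint_sub_le k l) (norm_sq_gridPoint_sub_le k' l')
  have hdir : gridPoint d ρ l 1 - gridPoint d ρ k 0 =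
      gridPoint d ρ l' 1 - gridPoint d ρ k' 0 := by
    by_contra hne
    have := inv_sq_le_norm_sq hρ (sub_ne_zero.2 hne) fun i =>
      exists_int_sub (exists_int_sub (h1 l i) (h0 k i)) (exists_int_sub (h1 l' i) (h0 k' i))
    nlinarith [mul_pos hε (show 0 < (d : ℝ) ^ 2 by positivity)]
  have hstart : gridPoint d ρ k' 0 = gridPoint d ρ k 0 := by
    by_contra hne
    have := inv_sq_le_norm_sq hρ (sub_ne_zero.2 hne) fun i => exists_int_sub (h0 k' i) (h0 k i)
    have hle := this.trans (hpar hdir)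
    have hε1 : ε < 1 := by nlinarith
    have : (2 * ε + ε ^ 2) * (d : ℝ) ^ 2 ≤ 3 * ε * (d : ℝ) ^ 2 := by gcongr; nlinarith
    nlinarith [mul_pos hε (show 0 < (d : ℝ) ^ 2 by positivity)]
  have hend : gridPoint d ρ l 1 = gridPoint d ρ l' 1 := by
    rw [hstart] at hdir
    exact sub_left_injective hdir
  exact Prod.ext (gridPoint_injective hρ 0 hstart).symm (gridPoint_injective hρ 1 hend)

end Grid

/-- Counting the pairs of grid points: each of them requires weight `1/3` of its own. -/
lemma IsSteinerSpanner.pow_div_three_le {d ρ : ℕ} {ε : ℝ} (hd : 2 ≤ d) (hε : 0 < ε)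
    (hεd : ε < ((8 * (d : ℝ)) ^ 2)⁻¹) (hρ : 0 < ρ)
    (hρε : 16 * ε * (d : ℝ) ^ 2 < ((ρ : ℝ) ^ 2)⁻¹)
    {V : Finset (EuclideanSpace ℝ (Fin d))} {E : Finset (Sym2 (EuclideanSpace ℝ (Fin d)))}
    (hN : IsSteinerSpanner ε (gridSet d ρ 0 ∪ gridSet d ρ 1) V E) :
    ((ρ : ℝ) ^ 2) ^ (d - 1) / 3 ≤ ∑ e ∈ E, edgeLen e := by
  classical
  let F : (Fin (d - 1) → Fin ρ) × (Fin (d - 1) → Fin ρ) →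
      Finset (Sym2 (EuclideanSpace ℝ (Fin d))) :=
    fun x => E.filter (IsGoodEdge ε (gridPoint d ρ x.1 0) (gridPoint d ρ x.2 1))
  have hρ' : (ρ : ℝ) ≠ 0 := by positivity
  have hF : ∀ x, (1 : ℝ) / 3 ≤ ∑ e ∈ F x, edgeLen e := by
    intro x
    refine le_trans ?_ (hN.third_le_sum_goodEdge hε
      (Or.inl (gridPoint_mem_gridSet x.1 ⟨0, by simp⟩))
      (Or.inr (gridPoint_mem_gridSet x.2 ⟨ρ, by simp [hρ']⟩)))
    gcongr
    have hlast : d - 1 < d := by omega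
    refine le_trans ?_ (PiLp.norm_apply_le _ ⟨d - 1, hlast⟩)
    simp [gridPoint_of_not_lt]
  have hdisj : Set.PairwiseDisjoint (↑(Finset.univ : Finset
      ((Fin (d - 1) → Fin ρ) × (Fin (d - 1) → Fin ρ)))) F := by
    intro x _ y _ hxy
    refine Finset.disjoint_left.2 fun e hx hy => hxy ?_
    exact eq_of_isGoodEdge hd hε hεd hρ hρε (Finset.mem_filter.1 hx).2 (Finset.mem_filter.1 hy).2
  calc ((ρ : ℝ) ^ 2) ^ (d - 1) / 3
      = ∑ _x : (Fin (d - 1) → Fin ρ) × (Fin (d - 1) → Fin ρ), (1 : ℝ) / 3 := by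
        simp [Fintype.card_prod]
        ring
    _ ≤ ∑ x, ∑ e ∈ F x, edgeLen e := Finset.sum_le_sum fun x _ => hF x
    _ = ∑ e ∈ Finset.univ.biUnion F, edgeLen e := (Finset.sum_biUnion hdisj).symm
    _ ≤ ∑ e ∈ E, edgeLen e := Finset.sum_le_sum_of_subset_of_nonneg
        (Finset.biUnion_subset.2 fun _ _ => Finset.filter_subset _ _)
        fun _ _ _ => edgeLen_nonneg _

-- **Statement 3.** For `d ≥ 2` there is `c_d > 0` such that for all `0 < ε < (8d)⁻²`,
-- every Euclidean Steiner `(1+ε)`-spanner for the two-grid set `S = S₀ ∪ S₁` has total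
-- weight at least `c_d · ε^{1−d}`.
theorem steiner_spanner_weight_lower_bound (d : ℕ) (hd : 2 ≤ d) :
    ∃ c : ℝ, 0 < c ∧
      ∀ ε : ℝ, 0 < ε → ε < ((8 * (d : ℝ)) ^ 2)⁻¹ →
      ∀ (V : Finset (EuclideanSpace ℝ (Fin d)))
        (E : Finset (Sym2 (EuclideanSpace ℝ (Fin d)))),
        IsSteinerSpanner ε
          (gridSet d ⌈1 / (8 * (d : ℝ) * Real.sqrt ε)⌉₊ 0 ∪
            gridSet d ⌈1 / (8 * (d : ℝ) * Real.sqrt ε)⌉₊ 1) V E →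
        c * ε ^ ((1 : ℝ) - (d : ℝ)) ≤ ∑ e ∈ E, edgeLen e := by
  have hd0 : (0 : ℝ) < d := by exact_mod_cast (by omega : 0 < d)
  refine ⟨(((8 * (d : ℝ)) ^ 2)⁻¹) ^ (d - 1) / 3, by positivity, ?_⟩
  intro ε hε hεd V E hN
  have hs : 0 < √ε := Real.sqrt_pos.2 hε
  have hsq : √ε ^ 2 = ε := Real.sq_sqrt hε.le
  set x : ℝ := 1 / (8 * (d : ℝ) * √ε) with hx
  have hx2 : x ^ 2 = ((8 * (d : ℝ)) ^ 2)⁻¹ * ε⁻¹ := by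
    rw [hx, div_pow, mul_pow, hsq, one_pow, one_div, mul_inv]
  have hx0 : 0 < x := by positivity
  have hx1 : 1 < x := by
    refine lt_of_pow_lt_pow_left₀ 2 hx0.le ?_
    rw [hx2, one_pow, ← div_eq_mul_inv, lt_div_iff₀ hε, one_mul]
    exact hεd
  have hle : x ≤ (⌈x⌉₊ : ℝ) := Nat.le_ceil x
  have hlt : (⌈x⌉₊ : ℝ) < 2 * x := (Nat.ceil_lt_add_one hx0.le).trans (by linarith)
  have hρ : 0 < ⌈x⌉₊ := Nat.ceil_pos.2 hx0
  have hρ' : (0 : ℝ) < (⌈x⌉₊ : ℝ) := by exact_mod_cast hρ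
  have hρε : 16 * ε * (d : ℝ) ^ 2 < ((⌈x⌉₊ : ℝ) ^ 2)⁻¹ := by
    rw [lt_inv_comm₀ (by positivity) (by positivity)]
    calc (⌈x⌉₊ : ℝ) ^ 2 < (2 * x) ^ 2 := by gcongr
      _ = (16 * ε * (d : ℝ) ^ 2)⁻¹ := by
        rw [mul_pow, hx2]; field_simp; norm_num
  refine le_trans ?_ (hN.pow_div_three_le hd hε hεd hρ hρε)
  have hpow : ε ^ ((1 : ℝ) - (d : ℝ)) = ε⁻¹ ^ (d - 1) := by
    rw [show (1 : ℝ) - d = -((d - 1 : ℕ) : ℝ) by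
      rw [Nat.cast_sub (by omega)]; push_cast; ring, Real.rpow_neg hε.le, Real.rpow_natCast,
      inv_pow]
  rw [hpow, div_mul_eq_mul_div, ← mul_pow, ← hx2]
  gcongr

end
end

section
/- Let d ≥ 2 be an integer and let ε satisfy 0 < ε < (8d)^{−2}. Let ρ = ⌈1/(8d·√ε)⌉, S₀ = (ρ^{−1}·ℤ^d) ∩ ([0,1]^{d−1} × {0}) and S₁ = (ρ^{−1}·ℤ^d) ∩ ([0,1]^{d−1} × {1}). Let (a₁, b₁), (a₂, b₂) ∈ S₀ × S₁ with {a₁, b₁} ≠ {a₂, b₂}. If the undirected angle between the segments a₁b₁ and a₂b₂ is strictly less than 4·√ε, then the two segments are parallel translates of each other, i.e. b₁ − a₁ = b₂ − a₂. -/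
open scoped RealInnerProductSpace

noncomputable section

/-- If `u` and `v` lie on the affine hyperplane `⟪e, ·⟫ = 1`, with `e` a unit vector, then the squared
area of the parallelogram spanned by `u` and `v` is at least `‖u - v‖ ^ 2`. -/
theorem norm_sub_sq_le_gram_of_inner_eq_one {E : Type*} [NormedAddCommGroup E]
    [InnerProductSpace ℝ E] {e u v : E} (he : ‖e‖ = 1) (hu : ⟪e, u⟫ = 1) (hv : ⟪e, v⟫ = 1) :
    ‖u - v‖ ^ 2 ≤ ‖u‖ ^ 2 * ‖v‖ ^ 2 - ⟪u, v⟫ ^ 2 := by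
  have cauchy := real_inner_mul_inner_self_le (u - e) (v - e)
  have hee : ⟪e, e⟫ = 1 := by rw [real_inner_self_eq_norm_sq, he]; norm_num
  have hue : ⟪u, e⟫ = 1 := by rw [real_inner_comm, hu]
  have hve : ⟪v, e⟫ = 1 := by rw [real_inner_comm, hv]
  simp only [inner_sub_left, inner_sub_right, hee, hu, hv, hue, hve,
    real_inner_self_eq_norm_sq] at cauchy
  rw [norm_sub_sq_real]
  nlinarith

/-- The squared sine of the undirected angle is at most the squared angle. -/
theorem gram_le_uangle_sq {d : ℕ} (u w : EuclideanSpace ℝ (Fin d)) :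
    ‖u‖ ^ 2 * ‖w‖ ^ 2 - ⟪u, w⟫ ^ 2 ≤ uangle u w ^ 2 * (‖u‖ ^ 2 * ‖w‖ ^ 2) := by
  rcases eq_or_ne (‖u‖ * ‖w‖) 0 with h | h
  · have : ‖u‖ ^ 2 * ‖w‖ ^ 2 = 0 := by rw [← mul_pow, h]; norm_num
    rw [this]
    nlinarith [sq_nonneg ⟪u, w⟫]
  · set x := |⟪u, w⟫| / (‖u‖ * ‖w‖) with hx
    have hx1 : x ≤ 1 := div_le_one_of_le₀ (abs_real_inner_le_norm u w) (by positivity)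
    have hx0 : 0 ≤ x := by positivity
    have hsin : √(1 - x ^ 2) ≤ uangle u w := by
      rw [← Real.sin_arccos]
      exact Real.sin_le (Real.arccos_nonneg _)
    have hsq : 1 - x ^ 2 ≤ uangle u w ^ 2 := by
      rw [← Real.sq_sqrt (show 0 ≤ 1 - x ^ 2 by nlinarith)]
      gcongr
    have hinner : ⟪u, w⟫ ^ 2 = x ^ 2 * (‖u‖ ^ 2 * ‖w‖ ^ 2) := by
      rw [← sq_abs ⟪u, w⟫, ← mul_pow, ← mul_pow, hx, div_mul_cancel₀ _ h]
    rw [hinner]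
    nlinarith [mul_le_mul_of_nonneg_right hsq (show 0 ≤ ‖u‖ ^ 2 * ‖w‖ ^ 2 by positivity)]

/-- The last coordinate of a difference of points of the top and bottom grids is `1`. -/
theorem gridSet_sub_apply_last {d ρ : ℕ} {a b : EuclideanSpace ℝ (Fin d)}
    (ha : a ∈ gridSet d ρ 0) (hb : b ∈ gridSet d ρ 1) {i : Fin d} (hi : (i : ℕ) = d - 1) :
    (b - a) i = 1 := by
  simp [(ha i).2.2 hi, (hb i).2.2 hi]

/-- A segment joining the bottom grid to the top grid has length at most `√d`. -/
theorem norm_sq_gridSet_sub_le {d ρ : ℕ} {a b : EuclideanSpace ℝ (Fin d)}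
    (ha : a ∈ gridSet d ρ 0) (hb : b ∈ gridSet d ρ 1) : ‖b - a‖ ^ 2 ≤ d := by
  rw [EuclideanSpace.real_norm_sq_eq]
  calc ∑ i, (b - a) i ^ 2 ≤ ∑ _i : Fin d, (1 : ℝ) := by
        refine Finset.sum_le_sum fun i _ => ?_
        rcases (show (i : ℕ) < d - 1 ∨ (i : ℕ) = d - 1 by omega) with hi | hi
        · obtain ⟨ha0, ha1⟩ := (ha i).2.1 hi
          obtain ⟨hb0, hb1⟩ := (hb i).2.1 hi
          rw [sq_le_one_iff_abs_le_one, PiLp.sub_apply, abs_le]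
          constructor <;> linarith
        · rw [gridSet_sub_apply_last ha hb hi, one_pow]
    _ = d := by simp

/-- Distinct difference vectors of grid points are at distance at least `1 / ρ`. -/
theorem one_le_mul_norm_sq_gridSet_sub_sub {d ρ : ℕ} (hρ : 0 < ρ) {s t s' t' : ℝ}
    {a₁ b₁ a₂ b₂ : EuclideanSpace ℝ (Fin d)}
    (ha₁ : a₁ ∈ gridSet d ρ s) (hb₁ : b₁ ∈ gridSet d ρ t)
    (ha₂ : a₂ ∈ gridSet d ρ s') (hb₂ : b₂ ∈ gridSet d ρ t') (hne : b₁ - a₁ ≠ b₂ - a₂) :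
    1 ≤ (ρ : ℝ) ^ 2 * ‖(b₁ - a₁) - (b₂ - a₂)‖ ^ 2 := by
  obtain ⟨i, hi⟩ : ∃ i, (b₁ - a₁) i ≠ (b₂ - a₂) i := by
    by_contra! h
    exact hne (PiLp.ext h)
  obtain ⟨z₁, hz₁⟩ := (ha₁ i).1
  obtain ⟨w₁, hw₁⟩ := (hb₁ i).1
  obtain ⟨z₂, hz₂⟩ := (ha₂ i).1
  obtain ⟨w₂, hw₂⟩ := (hb₂ i).1
  have hρ' : (ρ : ℝ) ≠ 0 := by positivity
  set k : ℤ := (w₁ - z₁) - (w₂ - z₂) with hk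
  have hcoord : (ρ : ℝ) * ((b₁ - a₁) - (b₂ - a₂)) i = k := by
    simp only [PiLp.sub_apply, hz₁, hw₁, hz₂, hw₂, hk]
    push_cast
    field_simp
  have hk0 : k ≠ 0 := by
    intro h
    rw [h, Int.cast_zero, mul_eq_zero, PiLp.sub_apply, sub_eq_zero] at hcoord
    exact hcoord.elim hρ' hi
  have hk1 : (1 : ℝ) ≤ (k : ℝ) ^ 2 := by
    exact_mod_cast (show 1 ≤ k ^ 2 by have := sq_pos_of_ne_zero hk0; omega)
  calc (1 : ℝ) ≤ (k : ℝ) ^ 2 := hk1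
    _ = (ρ : ℝ) ^ 2 * (((b₁ - a₁) - (b₂ - a₂)) i) ^ 2 := by rw [← hcoord, mul_pow]
    _ ≤ _ := by
      rw [EuclideanSpace.real_norm_sq_eq]
      gcongr
      exact Finset.single_le_sum (f := fun j => (((b₁ - a₁) - (b₂ - a₂)) j) ^ 2)
        (fun j _ => sq_nonneg _) (Finset.mem_univ i)

-- **Statement 6.** Let `(a₁, b₁), (a₂, b₂) ∈ S₀ × S₁` with `{a₁,b₁} ≠ {a₂,b₂}`. If the
-- undirected angle between the segments `a₁b₁` and `a₂b₂` is strictly less than `4·√ε`,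
-- then the segments are parallel translates of each other, i.e. `b₁ − a₁ = b₂ − a₂`.
theorem grid_pairs_parallel_of_small_angle
    (d : ℕ) (hd : 2 ≤ d) (ε : ℝ) (hε0 : 0 < ε) (hε1 : ε < ((8 * (d : ℝ)) ^ 2)⁻¹)
    (a₁ b₁ a₂ b₂ : EuclideanSpace ℝ (Fin d))
    (ha₁ : a₁ ∈ gridSet d ⌈1 / (8 * (d : ℝ) * Real.sqrt ε)⌉₊ 0)
    (ha₂ : a₂ ∈ gridSet d ⌈1 / (8 * (d : ℝ) * Real.sqrt ε)⌉₊ 0)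
    (hb₁ : b₁ ∈ gridSet d ⌈1 / (8 * (d : ℝ) * Real.sqrt ε)⌉₊ 1)
    (hb₂ : b₂ ∈ gridSet d ⌈1 / (8 * (d : ℝ) * Real.sqrt ε)⌉₊ 1)
    (hne : ({a₁, b₁} : Set (EuclideanSpace ℝ (Fin d))) ≠ {a₂, b₂})
    (hang : uangle (b₁ - a₁) (b₂ - a₂) < 4 * Real.sqrt ε) :
    b₁ - a₁ = b₂ - a₂ := by
  by_contra hdiff
  have hd0 : (0 : ℝ) < d := by positivity
  have hs0 : 0 < √ε := Real.sqrt_pos.2 hε0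
  have hs1 : 8 * (d : ℝ) * √ε < 1 := by
    have h : (8 * (d : ℝ) * √ε) ^ 2 < 1 := by
      rw [mul_pow, Real.sq_sqrt hε0.le, ← lt_inv_mul_iff₀ (by positivity), mul_one]
      exact hε1
    exact (sq_lt_one_iff₀ (by positivity)).1 h
  set ρ := ⌈1 / (8 * (d : ℝ) * √ε)⌉₊
  have hρ0 : 0 < ρ := Nat.ceil_pos.2 (by positivity)
  have hρ : (ρ : ℝ) * (4 * d * √ε) < 1 := by
    have hlt : (ρ : ℝ) < 1 / (8 * d * √ε) + 1 := Nat.ceil_lt_add_one (by positivity)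
    have hmul := mul_lt_mul_of_pos_right hlt (show 0 < 8 * (d : ℝ) * √ε by positivity)
    rw [add_mul, div_mul_cancel₀ _ (by positivity)] at hmul
    linarith
  let last : Fin d := ⟨d - 1, by omega⟩
  have hinner : ∀ x : EuclideanSpace ℝ (Fin d), x last = 1 →
      ⟪EuclideanSpace.single last (1 : ℝ), x⟫ = 1 := fun x hx => by
    rw [EuclideanSpace.inner_single_left, hx, map_one, mul_one]
  have hgram := norm_sub_sq_le_gram_of_inner_eq_one
    (show ‖EuclideanSpace.single last (1 : ℝ)‖ = 1 by simp)
    (hinner _ (gridSet_sub_apply_last ha₁ hb₁ rfl)) (hinner _ (gridSet_sub_apply_last ha₂ hb₂ rfl))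
  have hsep := one_le_mul_norm_sq_gridSet_sub_sub hρ0 ha₁ hb₁ ha₂ hb₂ hdiff
  have hbound : ‖(b₁ - a₁) - (b₂ - a₂)‖ ^ 2 ≤ (4 * √ε) ^ 2 * (d * d) := by
    refine (hgram.trans (gram_le_uangle_sq _ _)).trans ?_
    have hang0 : 0 ≤ uangle (b₁ - a₁) (b₂ - a₂) := Real.arccos_nonneg _
    gcongr
    · exact norm_sq_gridSet_sub_le ha₁ hb₁
    · exact norm_sq_gridSet_sub_le ha₂ hb₂
  have hlt : ((ρ : ℝ) * (4 * d * √ε)) ^ 2 < 1 := (sq_lt_one_iff₀ (by positivity)).2 hρ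
  have hle := mul_le_mul_of_nonneg_left hbound (sq_nonneg (ρ : ℝ))
  linarith [show (ρ : ℝ) ^ 2 * ((4 * √ε) ^ 2 * (d * d)) = ((ρ : ℝ) * (4 * d * √ε)) ^ 2 by ring]

end
end

section
/- There exists an absolute constant C > 0 such that for every ε ∈ (0, 1] the following holds. Let s = (0, ε^{−1/2}) and let L = [−1/2, 1/2] × {0} be a horizontal unit segment on the x-axis. Then there exists a geometric graph E with total weight ‖E‖ ≤ C · ε^{−1/2} such that for every point t ∈ L there is an st-path in E of weight at most (1+ε)·‖s − t‖. -/
open scoped Classical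

noncomputable section

/-- The Euclidean plane. -/
abbrev Plane : Type := EuclideanSpace ℝ (Fin 2)

/-- The point `(x, y) ∈ ℝ²`. -/
def pt (x y : ℝ) : Plane := (EuclideanSpace.equiv (Fin 2) ℝ).symm ![x, y]

/-- The union of the segments of a geometric graph. -/
def segUnion (E : Finset (Plane × Plane)) : Set Plane :=
  ⋃ e ∈ E, segment ℝ e.1 e.2

/-- The total weight of a geometric graph: the sum of the Euclidean lengths of its
segments. -/
def gweight (E : Finset (Plane × Plane)) : ℝ :=
  ∑ e ∈ E, ‖e.1 - e.2‖

/-- `HasPath E s t w` : there is a polygonal path from `s` to `t`, each of whose edges is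
contained in the union of the segments of `E`, of weight at most `w`. -/
def HasPath (E : Finset (Plane × Plane)) (s t : Plane) (w : ℝ) : Prop :=
  ∃ (m : ℕ) (v : ℕ → Plane), v 0 = s ∧ v m = t ∧
    (∀ i < m, segment ℝ (v i) (v (i + 1)) ⊆ segUnion E) ∧
    ∑ i ∈ Finset.range m, ‖v (i + 1) - v i‖ ≤ w

theorem dist_pt (a b c d : ℝ) :
    ‖pt a b - pt c d‖ = Real.sqrt ((a - c) ^ 2 + (b - d) ^ 2) := by
  simp [EuclideanSpace.norm_eq, pt, Fin.sum_univ_two]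

theorem dist_pt_le {a b c d e : ℝ} (he : 0 ≤ e) (h : (a - c) ^ 2 + (b - d) ^ 2 ≤ e ^ 2) :
    ‖pt a b - pt c d‖ ≤ e := by
  rw [dist_pt]
  exact Real.sqrt_le_iff.mpr ⟨he, h⟩

theorem pt_mem_segment {a b x : ℝ} (y : ℝ) (h : x ∈ Set.Icc a b) :
    pt x y ∈ segment ℝ (pt a y) (pt b y) := by
  rw [← segment_eq_Icc (h.1.trans h.2)] at h
  obtain ⟨p, q, hp, hq, hpq, rfl⟩ := h
  refine ⟨p, q, hp, hq, hpq, ?_⟩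
  ext i
  fin_cases i <;> simp [pt, ← add_mul, hpq]

theorem exists_eq_pt_of_mem_segment {a b y : ℝ} (hab : a ≤ b) {t : Plane}
    (h : t ∈ segment ℝ (pt a y) (pt b y)) : ∃ x ∈ Set.Icc a b, t = pt x y := by
  obtain ⟨p, q, hp, hq, hpq, rfl⟩ := h
  refine ⟨p * a + q * b, ?_, ?_⟩
  · rw [← segment_eq_Icc hab]
    exact ⟨p, q, hp, hq, hpq, rfl⟩
  · ext i
    fin_cases i <;> simp [pt, ← add_mul, hpq]

theorem segment_subset_segUnion {E : Finset (Plane × Plane)} {a b : Plane} (h : (a, b) ∈ E) :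
    segment ℝ a b ⊆ segUnion E :=
  Set.subset_biUnion_of_mem (u := fun e : Plane × Plane => segment ℝ e.1 e.2) h

theorem segUnion_mono {E F : Finset (Plane × Plane)} (h : E ⊆ F) : segUnion E ⊆ segUnion F :=
  Set.biUnion_subset_biUnion_left h

theorem gweight_union_le (E F : Finset (Plane × Plane)) :
    gweight (E ∪ F) ≤ gweight E + gweight F := by
  unfold gweight
  rw [← Finset.sum_union_inter]
  exact le_add_of_nonneg_right (Finset.sum_nonneg fun _ _ => norm_nonneg _)

theorem gweight_pair_le (e f : Plane × Plane) :
    gweight {e, f} ≤ ‖e.1 - e.2‖ + ‖f.1 - f.2‖ := by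
  simpa [gweight] using gweight_union_le {e} {f}

theorem HasPath.mono {E F : Finset (Plane × Plane)} {s t : Plane} {w w' : ℝ}
    (h : HasPath E s t w) (hEF : E ⊆ F) (hw : w ≤ w') : HasPath F s t w' := by
  obtain ⟨m, v, h0, hm, hv, hs⟩ := h
  exact ⟨m, v, h0, hm, fun i hi => (hv i hi).trans (segUnion_mono hEF), hs.trans hw⟩

theorem HasPath.refl (E : Finset (Plane × Plane)) (s : Plane) : HasPath E s s 0 :=
  ⟨0, fun _ => s, rfl, rfl, by simp, by simp⟩

theorem HasPath.cons {E : Finset (Plane × Plane)} {a b t : Plane} {w : ℝ}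
    (hab : segment ℝ a b ⊆ segUnion E) (h : HasPath E b t w) :
    HasPath E a t (‖b - a‖ + w) := by
  obtain ⟨m, v, h0, hm, hv, hs⟩ := h
  refine ⟨m + 1, fun i => Nat.casesOn i a v, rfl, hm, ?_, ?_⟩
  · rintro (_ | i) hi
    · simpa [h0] using hab
    · exact hv i (by omega)
  · rw [Finset.sum_range_succ', add_comm]
    simpa [h0] using hs

/-- The binary tree of depth `k` with root `(x, H)` over the segment of width `w` centred at
`(x, 0)`: each level halves the width and scales the height by `3/8`; the leaves drop vertically
to the segment. -/
theorem exists_binary_tree (k : ℕ) : ∀ x w H : ℝ, 0 < w → 0 < H →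
    ∃ E : Finset (Plane × Plane),
      gweight E ≤ 5 * H + w * (1 + k / 2) ∧
      ∀ z ∈ Set.Icc (x - w / 2) (x + w / 2),
        HasPath E (pt x H) (pt z 0) (H + 3 / 20 * (w ^ 2 / H) + w / 2 ^ (k + 1)) := by
  induction k with
  | zero =>
    intro x w H hw hH
    refine ⟨{(pt x H, pt x 0), (pt (x - w / 2) 0, pt (x + w / 2) 0)}, ?_, ?_⟩
    · have h₁ : ‖pt x H - pt x 0‖ ≤ H := dist_pt_le hH.le (by simp)
      have h₂ : ‖pt (x - w / 2) 0 - pt (x + w / 2) 0‖ ≤ w :=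
        dist_pt_le hw.le (le_of_eq (by ring))
      have h₃ := gweight_pair_le (pt x H, pt x 0) (pt (x - w / 2) 0, pt (x + w / 2) 0)
      simp only [Nat.cast_zero] at h₃ ⊢
      linarith
    · intro z hz
      set E : Finset (Plane × Plane) :=
        {(pt x H, pt x 0), (pt (x - w / 2) 0, pt (x + w / 2) 0)} with hE
      have hvert : segment ℝ (pt x H) (pt x 0) ⊆ segUnion E :=
        segment_subset_segUnion (by simp [hE])
      have hhor : segment ℝ (pt x 0) (pt z 0) ⊆ segUnion E :=
        ((convex_segment _ _).segment_subset
          (pt_mem_segment 0 ⟨by linarith, by linarith⟩) (pt_mem_segment 0 hz)).trans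
          (segment_subset_segUnion (by simp [hE]))
      refine (HasPath.cons hvert (HasPath.cons hhor (HasPath.refl E _))).mono subset_rfl ?_
      have h₁ : ‖pt x 0 - pt x H‖ ≤ H := dist_pt_le hH.le (by simp)
      have h₂ : ‖pt z 0 - pt x 0‖ ≤ w / 2 :=
        dist_pt_le (by linarith) (by nlinarith [hz.1, hz.2])
      have h₃ : 0 ≤ w ^ 2 / H := by positivity
      simp only [zero_add, pow_one]
      linarith
  | succ k ih =>
    intro x w H hw hH
    obtain ⟨E₁, hE₁, hp₁⟩ := ih (x - w / 4) (w / 2) (3 / 8 * H) (by positivity) (by positivity)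
    obtain ⟨E₂, hE₂, hp₂⟩ := ih (x + w / 4) (w / 2) (3 / 8 * H) (by positivity) (by positivity)
    set F : Finset (Plane × Plane) :=
      {(pt x H, pt (x - w / 4) (3 / 8 * H)), (pt x H, pt (x + w / 4) (3 / 8 * H))} with hF
    refine ⟨F ∪ (E₁ ∪ E₂), ?_, ?_⟩
    · have h₁ : ‖pt x H - pt (x - w / 4) (3 / 8 * H)‖ ≤ 5 / 8 * H + w / 4 :=
        dist_pt_le (by positivity) (by nlinarith [mul_pos hw hH])
      have h₂ : ‖pt x H - pt (x + w / 4) (3 / 8 * H)‖ ≤ 5 / 8 * H + w / 4 :=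
        dist_pt_le (by positivity) (by nlinarith [mul_pos hw hH])
      have h₃ := gweight_pair_le (pt x H, pt (x - w / 4) (3 / 8 * H))
        (pt x H, pt (x + w / 4) (3 / 8 * H))
      have h₄ := gweight_union_le F (E₁ ∪ E₂)
      have h₅ := gweight_union_le E₁ E₂
      rw [← hF] at h₃
      simp only at h₃
      push_cast
      linarith
    · intro z hz
      have key : ∀ d : ℝ, d ^ 2 = (w / 4) ^ 2 →
          ‖pt (x + d) (3 / 8 * H) - pt x H‖ ≤ 5 / 8 * H + w ^ 2 / (20 * H) := by
        intro d hd
        refine dist_pt_le (by positivity) ?_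
        have h₁ : (5 / 8 * H + w ^ 2 / (20 * H)) ^ 2
            = (5 / 8 * H) ^ 2 + (w / 4) ^ 2 + (w ^ 2 / (20 * H)) ^ 2 := by
          field_simp
          ring
        have h₂ := sq_nonneg (w ^ 2 / (20 * H))
        rw [h₁, add_sub_cancel_left, hd]
        linarith
      have hexcess : w ^ 2 / (20 * H) + 3 / 20 * ((w / 2) ^ 2 / (3 / 8 * H))
          = 3 / 20 * (w ^ 2 / H) := by
        field_simp
        ring
      have htail : w / 2 / 2 ^ (k + 1) = w / 2 ^ (k + 1 + 1) := by
        rw [div_div, ← pow_succ']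
      rcases le_total z x with hzx | hzx
      · have hpath := (hp₁ z ⟨by linarith [hz.1], by linarith⟩).mono
          (Finset.subset_union_left.trans Finset.subset_union_right :
            E₁ ⊆ F ∪ (E₁ ∪ E₂)) le_rfl
        refine (HasPath.cons (segment_subset_segUnion (by simp [hF])) hpath).mono subset_rfl ?_
        have h := key (-(w / 4)) (by ring)
        rw [← sub_eq_add_neg] at h
        linarith
      · have hpath := (hp₂ z ⟨by linarith, by linarith [hz.2]⟩).mono
          (Finset.subset_union_right.trans Finset.subset_union_right :
            E₂ ⊆ F ∪ (E₁ ∪ E₂)) le_rfl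
        refine (HasPath.cons (segment_subset_segUnion (by simp [hF])) hpath).mono subset_rfl ?_
        have h := key (w / 4) rfl
        linarith

-- **Statement 9.** (Shallow-light tree for a segment.) There is an absolute constant
-- `C > 0` such that for every `ε ∈ (0,1]` there is a geometric graph `E` of weight at
-- most `C · ε^{-1/2}` containing, for every point `t` of the segment
-- `L = [−1/2, 1/2] × {0}`, a path from `s = (0, ε^{-1/2})` to `t` of weight at most
-- `(1+ε)·‖s − t‖`.
theorem slt_segment_exists :
    ∃ C : ℝ, 0 < C ∧
      ∀ ε : ℝ, 0 < ε → ε ≤ 1 →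
      ∃ E : Finset (Plane × Plane),
        gweight E ≤ C * (Real.sqrt ε)⁻¹ ∧
        ∀ t ∈ segment ℝ (pt (-(1/2)) 0) (pt (1/2) 0),
          HasPath E (pt 0 (Real.sqrt ε)⁻¹) t ((1 + ε) * ‖pt 0 (Real.sqrt ε)⁻¹ - t‖) := by
  refine ⟨7, by norm_num, fun ε hε hε1 => ?_⟩
  set h : ℝ := (Real.sqrt ε)⁻¹ with hh
  have hsqrt : 0 < Real.sqrt ε := Real.sqrt_pos.mpr hε
  have hpos : 0 < h := inv_pos.mpr hsqrt
  have hone : 1 ≤ h := (one_le_inv₀ hsqrt).mpr (Real.sqrt_le_one.mpr hε1)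
  have hslack : ε * h = 1 / h := by
    rw [hh]
    field_simp
    exact (Real.sq_sqrt hε.le).symm
  obtain ⟨E, hE, hpath⟩ := exists_binary_tree ⌈h⌉₊ 0 1 h one_pos hpos
  refine ⟨E, ?_, fun t ht => ?_⟩
  · have := Nat.ceil_lt_add_one hpos.le
    linarith
  · obtain ⟨z, hz, rfl⟩ := exists_eq_pt_of_mem_segment (by norm_num) ht
    refine (hpath z ⟨by linarith [hz.1], by linarith [hz.2]⟩).mono subset_rfl ?_
    have hdist : h ≤ ‖pt 0 h - pt z 0‖ := by
      rw [dist_pt]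
      exact Real.le_sqrt_of_sq_le (by nlinarith [sq_nonneg z])
    have hpow : h ≤ 2 ^ ⌈h⌉₊ :=
      (Nat.le_ceil h).trans (by exact_mod_cast Nat.lt_two_pow_self.le)
    have htail : (1 : ℝ) / 2 ^ (⌈h⌉₊ + 1) ≤ 1 / 2 * (1 / h) := by
      rw [pow_succ, ← one_div_mul_one_div, mul_comm]
      gcongr
    have hinv : 0 < 1 / h := by positivity
    calc h + 3 / 20 * (1 ^ 2 / h) + 1 / 2 ^ (⌈h⌉₊ + 1)
        ≤ h + ε * h := by rw [hslack, one_pow]; linarith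
      _ = (1 + ε) * h := by ring
      _ ≤ (1 + ε) * ‖pt 0 h - pt z 0‖ := by gcongr

end
end
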